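/- Let σ, τ be partial ballots on m candidates. Let σ' be the partial ballot obtained from σ by appending, in the order of their appearance in τ, those candidates listed in τ but not in σ; let τ' be defined symmetrically by appending to τ the candidates listed in σ but not in τ, in their order of appearance in σ. Then: (i) str(σ',τ') = str(σ,τ) and wk(σ',τ') = 0; (ii) d_B(σ,σ') + d_B(τ,τ') = (1/2)·wk(σ,τ) and d_B(σ,τ) = (1/2)·wk(σ,τ) + d_B(σ',τ'); and (iii) d_H(σ,σ') + d_H(τ,τ') = (1/2)·wk(σ,τ) and d_H(σ,τ) = (1/2)·wk(σ,τ) + str(σ',τ'). -/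

import Mathlib

/-- `σ` is the rank function of a (possibly partial) ballot on `m` candidates, under the
pessimistic convention: the `k` listed candidates get their positions `1,…,k` and all
unlisted candidates get rank `m`.  (A ballot listing `m-1` candidates has the same rank
function as its unique completion, realizing the identification of such ballots.) -/
def IsBallot (m : ℕ) (σ : Fin m → ℕ) : Prop :=
  (∀ i, 1 ≤ σ i ∧ σ i ≤ m) ∧
  (∀ i i', σ i < m → σ i = σ i' → i = i') ∧
  (∀ i j, 1 ≤ j → j ≤ σ i → σ i < m → ∃ i', σ i' = j)

/-- A partial ballot on `m` candidates, encoded by its rank function. -/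
def Ballot (m : ℕ) : Type := {σ : Fin m → ℕ // IsBallot m σ}

/-- The Borda embedding: candidate `i` receives `m - σ i` Borda points. -/
noncomputable def bordaEmb (m : ℕ) (σ : Fin m → ℕ) (i : Fin m) : ℝ :=
  (m : ℝ) - (σ i : ℝ)

/-- The Borda distance: half the `L¹` distance between Borda embeddings. -/
noncomputable def dB (m : ℕ) (σ τ : Fin m → ℕ) : ℝ :=
  (1 / 2) * ∑ i, |bordaEmb m σ i - bordaEmb m τ i|

/-- The head-to-head coordinate of the pair `(i,j)`: `+1` if `σ i > σ j`, `0` on a tie,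
`-1` if `σ i < σ j`. -/
noncomputable def hcoord {m : ℕ} (σ : Fin m → ℕ) (i j : Fin m) : ℝ :=
  if σ j < σ i then 1 else if σ i = σ j then 0 else -1

/-- The head-to-head distance: half the `L¹` distance between head-to-head embeddings,
summing over pairs `i < j`. -/
noncomputable def dH {m : ℕ} (σ τ : Fin m → ℕ) : ℝ :=
  (1 / 2) * ∑ p ∈ Finset.univ.filter (fun p : Fin m × Fin m => p.1 < p.2),
    |hcoord σ p.1 p.2 - hcoord τ p.1 p.2|

/-- The number of strong disagreements: pairs strictly ranked in opposite orders. -/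
def strDis {m : ℕ} (σ τ : Fin m → ℕ) : ℕ :=
  (Finset.univ.filter (fun p : Fin m × Fin m => p.1 < p.2 ∧
    ((σ p.1 < σ p.2 ∧ τ p.2 < τ p.1) ∨ (σ p.2 < σ p.1 ∧ τ p.1 < τ p.2)))).card

/-- The number of weak disagreements: pairs tied by exactly one of the two ballots. -/
def wkDis {m : ℕ} (σ τ : Fin m → ℕ) : ℕ :=
  (Finset.univ.filter (fun p : Fin m × Fin m => p.1 < p.2 ∧
    ((σ p.1 = σ p.2 ∧ τ p.1 ≠ τ p.2) ∨ (σ p.1 ≠ σ p.2 ∧ τ p.1 = τ p.2)))).card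

/-- Candidate `i` is unlisted in (left blank by) the ballot `σ`: it is tied at the end
of the ballot with at least one other candidate.  (A unique candidate of rank `m` is
the last candidate of a complete ballot, hence listed.) -/
def UnlistedIn (m : ℕ) (σ : Ballot m) (i : Fin m) : Prop :=
  σ.1 i = m ∧ ∃ i', i' ≠ i ∧ σ.1 i' = m

/-- `σ'` is the ballot obtained from `σ` by appending, in the order of their
appearance in `τ`, those candidates listed in `τ` but not in `σ`:  `σ'` agrees with
`σ` on `σ`'s listed candidates, keeps the candidates unlisted in both `σ` and `τ`
unlisted, lists the candidates unlisted in `σ` but listed in `τ`, and orders the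
appended candidates as `τ` does. -/
def IsAppend (m : ℕ) (σ τ σ' : Ballot m) : Prop :=
  (∀ i, ¬ UnlistedIn m σ i → σ'.1 i = σ.1 i) ∧
  (∀ i, UnlistedIn m σ i → UnlistedIn m τ i → σ'.1 i = m) ∧
  (∀ i, UnlistedIn m σ i → ¬ UnlistedIn m τ i → ¬ UnlistedIn m σ' i) ∧
  (∀ i j, UnlistedIn m σ i → UnlistedIn m σ j → ¬ UnlistedIn m τ i → ¬ UnlistedIn m τ j →
    (σ'.1 i < σ'.1 j ↔ τ.1 i < τ.1 j))

namespace IsBallot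

variable {m : ℕ} {σ : Fin m → ℕ}

/-- The Borda score of a candidate is the number of candidates ranked strictly below it. -/
theorem bordaEmb_eq_card (h : IsBallot m σ) (i : Fin m) :
    bordaEmb m σ i = ((Finset.univ.filter (fun j => σ i < σ j)).card : ℝ) := by
  obtain ⟨hrange, hinj, hsurj⟩ := h
  have key : (Finset.univ.filter (fun j => σ i < σ j)).card + σ i = m := by
    rcases (hrange i).2.lt_or_eq with hi | hi
    · have himage : (Finset.univ.filter (fun j => ¬ σ i < σ j)).image σ = Finset.Icc 1 (σ i) := by
        ext x
        simp only [Finset.mem_image, Finset.mem_filter, Finset.mem_univ, true_and, Finset.mem_Icc,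
          not_lt]
        constructor
        · rintro ⟨j, hj, rfl⟩
          exact ⟨(hrange j).1, hj⟩
        · rintro ⟨h1, h2⟩
          obtain ⟨j, rfl⟩ := hsurj i x h1 h2 hi
          exact ⟨j, h2, rfl⟩
      have hcard : (Finset.univ.filter (fun j => ¬ σ i < σ j)).card = σ i := by
        rw [← Finset.card_image_of_injOn (f := σ), himage, Nat.card_Icc, Nat.add_sub_cancel]
        intro a ha b _ hab
        simp only [Finset.coe_filter, Finset.mem_univ, true_and, Set.mem_ofPred_eq, not_lt] at ha
        exact hinj a b (ha.trans_lt hi) hab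
      have hsplit := Finset.card_filter_add_card_filter_not
        (s := (Finset.univ : Finset (Fin m))) (fun j => σ i < σ j)
      rw [hcard, Finset.card_univ, Fintype.card_fin] at hsplit
      exact hsplit
    · have hempty : Finset.univ.filter (fun j => σ i < σ j) = ∅ :=
        Finset.filter_eq_empty_iff.mpr fun j _ => by
          have := (hrange j).2
          omega
      rw [hempty, Finset.card_empty, zero_add, hi]
  have key' : ((Finset.univ.filter (fun j => σ i < σ j)).card : ℝ) + σ i = m := by
    exact_mod_cast key
  rw [bordaEmb, ← key']
  ring

end IsBallot

theorem not_unlistedIn_of_lt {m : ℕ} {σ : Ballot m} {i : Fin m} (h : σ.1 i < m) :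
    ¬ UnlistedIn m σ i := fun hu => h.ne hu.1

theorem unlistedIn_of_eq {m : ℕ} {σ : Ballot m} {i j : Fin m} (hij : i ≠ j)
    (h : σ.1 i = σ.1 j) : UnlistedIn m σ i := by
  have hi : σ.1 i = m := by
    rcases (σ.2.1 i).2.lt_or_eq with hi | hi
    · exact absurd (σ.2.2.1 i j hi h) hij
    · exact hi
  exact ⟨hi, j, hij.symm, h ▸ hi⟩

theorem lt_of_not_unlistedIn {m : ℕ} {σ : Ballot m} {i j : Fin m} (hi : ¬ UnlistedIn m σ i)
    (hij : i ≠ j) (hj : σ.1 j = m) : σ.1 i < m :=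
  lt_of_le_of_ne (σ.2.1 i).2 fun h => hi ⟨h, j, hij.symm, hj⟩

namespace IsAppend

variable {m : ℕ} {σ τ σ' : Ballot m}

theorem lt_of_lt (h : IsAppend m σ τ σ') {i j : Fin m} (hij : σ.1 i < σ.1 j) :
    σ'.1 i < σ'.1 j := by
  have hi : σ.1 i < m := hij.trans_le (σ.2.1 j).2
  have hi' := h.1 i (not_unlistedIn_of_lt hi)
  by_cases hj : UnlistedIn m σ j
  · by_contra! hle
    rw [hi'] at hle
    obtain ⟨k, hk⟩ := σ.2.2.2 i (σ'.1 j) (σ'.2.1 j).1 hle hi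
    have hkm : σ.1 k < m := hk ▸ hle.trans_lt hi
    have hk' := h.1 k (not_unlistedIn_of_lt hkm)
    have hkj : k = j := σ'.2.2.1 k j (hk' ▸ hkm) (hk'.trans hk)
    exact hkm.ne (hkj ▸ hj.1)
  · rwa [hi', h.1 j hj]

theorem lt_of_eq_of_lt (h : IsAppend m σ τ σ') {i j : Fin m} (hσ : σ.1 i = σ.1 j)
    (hτ : τ.1 i < τ.1 j) : σ'.1 i < σ'.1 j := by
  have hij : i ≠ j := fun e => hτ.ne (e ▸ rfl)
  have hi := unlistedIn_of_eq hij hσ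
  have hj := unlistedIn_of_eq hij.symm hσ.symm
  have hτi : ¬ UnlistedIn m τ i := not_unlistedIn_of_lt (hτ.trans_le (τ.2.1 j).2)
  by_cases hτj : UnlistedIn m τ j
  · have hj' := h.2.1 j hj hτj
    rw [hj']
    exact lt_of_not_unlistedIn (h.2.2.1 i hi hτi) hij hj'
  · exact (h.2.2.2 i j hi hj hτi hτj).mpr hτ

theorem eq_of_eq_of_eq (h : IsAppend m σ τ σ') {i j : Fin m} (hσ : σ.1 i = σ.1 j)
    (hτ : τ.1 i = τ.1 j) : σ'.1 i = σ'.1 j := by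
  by_cases hij : i = j
  · rw [hij]
  · rw [h.2.1 i (unlistedIn_of_eq hij hσ) (unlistedIn_of_eq hij hτ),
      h.2.1 j (unlistedIn_of_eq (Ne.symm hij) hσ.symm) (unlistedIn_of_eq (Ne.symm hij) hτ.symm)]

/-- Appending refines the order of `σ` lexicographically by the order of `τ`. -/
theorem lt_iff (h : IsAppend m σ τ σ') (i j : Fin m) :
    σ'.1 i < σ'.1 j ↔ σ.1 i < σ.1 j ∨ (σ.1 i = σ.1 j ∧ τ.1 i < τ.1 j) := by
  refine ⟨fun hlt => ?_, fun hlt => hlt.elim h.lt_of_lt fun ⟨h1, h2⟩ => h.lt_of_eq_of_lt h1 h2⟩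
  rcases lt_trichotomy (σ.1 i) (σ.1 j) with hσ | hσ | hσ
  · exact Or.inl hσ
  · rcases lt_trichotomy (τ.1 i) (τ.1 j) with hτ | hτ | hτ
    · exact Or.inr ⟨hσ, hτ⟩
    · exact absurd (h.eq_of_eq_of_eq hσ hτ) hlt.ne
    · exact absurd (h.lt_of_eq_of_lt hσ.symm hτ) hlt.asymm
  · exact absurd (h.lt_of_lt hσ) hlt.asymm

theorem eq_iff (h : IsAppend m σ τ σ') (i j : Fin m) :
    σ'.1 i = σ'.1 j ↔ σ.1 i = σ.1 j ∧ τ.1 i = τ.1 j := by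
  have h1 := h.lt_iff i j
  have h2 := h.lt_iff j i
  omega

end IsAppend

/-- The number of candidates tied with `i` by `σ` and ranked strictly below `i` by `τ`. -/
def tieBreak {m : ℕ} (σ τ : Fin m → ℕ) (i : Fin m) : ℕ :=
  (Finset.univ.filter (fun j => σ i = σ j ∧ τ i < τ j)).card

theorem IsAppend.bordaEmb_eq {m : ℕ} {σ τ σ' : Ballot m} (h : IsAppend m σ τ σ') (i : Fin m) :
    bordaEmb m σ'.1 i = bordaEmb m σ.1 i + tieBreak σ.1 τ.1 i := by
  rw [σ'.2.bordaEmb_eq_card, σ.2.bordaEmb_eq_card, tieBreak, ← Nat.cast_add,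
    ← Finset.card_union_of_disjoint, ← Finset.filter_or]
  · simp only [h.lt_iff]
  · exact Finset.disjoint_filter.mpr fun j _ h1 h2 => h1.ne h2.1

theorem tieBreak_le_bordaEmb {m : ℕ} (σ τ : Ballot m) (i : Fin m) :
    (tieBreak σ.1 τ.1 i : ℝ) ≤ bordaEmb m τ.1 i := by
  rw [τ.2.bordaEmb_eq_card, tieBreak]
  exact Nat.cast_le.mpr <| Finset.card_le_card fun j hj =>
    Finset.mem_filter.mpr ⟨Finset.mem_univ j, (Finset.mem_filter.mp hj).2.2⟩

theorem tieBreak_eq_zero_or_bordaEmb_eq_zero {m : ℕ} (σ τ : Ballot m) (i : Fin m) :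
    (tieBreak σ.1 τ.1 i : ℝ) = 0 ∨ bordaEmb m σ.1 i = 0 := by
  refine or_iff_not_imp_left.mpr fun h => ?_
  rw [tieBreak, Nat.cast_eq_zero] at h
  obtain ⟨j, hj⟩ := Finset.card_ne_zero.mp h
  simp only [Finset.mem_filter, Finset.mem_univ, true_and] at hj
  have hij : i ≠ j := fun e => hj.2.ne (congrArg τ.1 e)
  rw [bordaEmb, (unlistedIn_of_eq hij hj.1).1, sub_self]

/-- An asymmetric relation holds for as many ordered pairs as there are unordered pairs that it
relates in some direction. -/
theorem card_filter_asymm {m : ℕ} (R : Fin m → Fin m → Prop) [DecidableRel R]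
    (hR : ∀ i j, R i j → ¬ R j i) :
    ∑ i, (Finset.univ.filter (R i)).card =
      (Finset.univ.filter (fun p : Fin m × Fin m =>
        p.1 < p.2 ∧ (R p.1 p.2 ∨ R p.2 p.1))).card := by
  have hswap : ∑ p : Fin m × Fin m, (if p.2 < p.1 ∧ R p.1 p.2 then 1 else 0) =
      ∑ p : Fin m × Fin m, if p.1 < p.2 ∧ R p.2 p.1 then 1 else 0 :=
    Fintype.sum_equiv (Equiv.prodComm _ _) _ _ fun _ => rfl
  have hsplit : ∑ p : Fin m × Fin m, (if R p.1 p.2 then 1 else 0) =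
      ∑ p : Fin m × Fin m, (if p.1 < p.2 ∧ R p.1 p.2 then 1 else 0) +
        ∑ p : Fin m × Fin m, if p.2 < p.1 ∧ R p.1 p.2 then 1 else 0 := by
    rw [← Finset.sum_add_distrib]
    refine Finset.sum_congr rfl fun ⟨i, j⟩ _ => ?_
    have := hR i j
    rcases lt_trichotomy i j with h | rfl | h
    · simp [h, h.asymm]
    · simp_all
    · simp [h, h.asymm]
  simp only [Finset.card_filter]
  rw [← Fintype.sum_prod_type' (f := fun i j => if R i j then 1 else 0), hsplit, hswap,
    ← Finset.sum_add_distrib]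
  refine Finset.sum_congr rfl fun ⟨i, j⟩ _ => ?_
  have := hR i j
  by_cases h1 : i < j <;> by_cases h2 : R i j <;> by_cases h3 : R j i <;> simp_all

theorem sum_tieBreak {m : ℕ} (σ τ : Fin m → ℕ) :
    ∑ i, (tieBreak σ τ i + tieBreak τ σ i) = wkDis σ τ := by
  have hsum : ∀ i, tieBreak σ τ i + tieBreak τ σ i = (Finset.univ.filter
      (fun j => (σ i = σ j ∧ τ i < τ j) ∨ (τ i = τ j ∧ σ i < σ j))).card := fun i => by
    rw [tieBreak, tieBreak, ← Finset.card_union_of_disjoint, ← Finset.filter_or]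
    exact Finset.disjoint_filter.mpr fun j _ h1 h2 => h1.2.ne h2.1
  simp only [hsum]
  rw [card_filter_asymm (fun i j => (σ i = σ j ∧ τ i < τ j) ∨ (τ i = τ j ∧ σ i < σ j))
    (fun i j h => by omega), wkDis]
  congr 1
  refine Finset.filter_congr fun p _ => and_congr_right fun _ => ?_
  omega

theorem IsAppend.dB_eq {m : ℕ} {σ τ σ' : Ballot m} (h : IsAppend m σ τ σ') :
    dB m σ.1 σ'.1 = (1 / 2) * ∑ i, (tieBreak σ.1 τ.1 i : ℝ) := by
  rw [dB]
  congr 1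
  refine Finset.sum_congr rfl fun i _ => ?_
  rw [h.bordaEmb_eq, sub_add_cancel_left, abs_neg, Nat.abs_cast]

theorem abs_hcoord_sub {m : ℕ} (σ τ : Fin m → ℕ) (i j : Fin m) :
    |hcoord σ i j - hcoord τ i j| =
      (if (σ i = σ j ∧ τ i ≠ τ j) ∨ (σ i ≠ σ j ∧ τ i = τ j) then 1 else 0) +
        2 * (if (σ i < σ j ∧ τ j < τ i) ∨ (σ j < σ i ∧ τ i < τ j) then 1 else 0) := by
  unfold hcoord
  split_ifs <;> first | omega | norm_num

theorem dH_eq {m : ℕ} (σ τ : Fin m → ℕ) :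
    dH σ τ = (wkDis σ τ : ℝ) / 2 + strDis σ τ := by
  simp only [dH, wkDis, strDis, abs_hcoord_sub, Finset.sum_add_distrib, ← Finset.mul_sum,
    ← Finset.filter_filter _ _ Finset.univ, Finset.sum_boole]
  ring

theorem IsAppend.strDis_eq_zero {m : ℕ} {σ τ σ' : Ballot m} (h : IsAppend m σ τ σ') :
    strDis σ.1 σ'.1 = 0 := by
  rw [strDis, Finset.card_eq_zero, Finset.filter_eq_empty_iff]
  intro p _
  have h1 := h.lt_iff p.1 p.2
  have h2 := h.lt_iff p.2 p.1
  omega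

theorem IsAppend.wkDis_add {m : ℕ} {σ τ σ' τ' : Ballot m} (hσ' : IsAppend m σ τ σ')
    (hτ' : IsAppend m τ σ τ') : wkDis σ.1 σ'.1 + wkDis τ.1 τ'.1 = wkDis σ.1 τ.1 := by
  rw [wkDis, wkDis, wkDis, ← Finset.card_union_of_disjoint, ← Finset.filter_or]
  · congr 1
    refine Finset.filter_congr fun p _ => ?_
    have h1 := hσ'.eq_iff p.1 p.2
    have h2 := hτ'.eq_iff p.1 p.2
    tauto
  · refine Finset.disjoint_filter.mpr fun p _ => ?_
    have h1 := hσ'.eq_iff p.1 p.2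
    have h2 := hτ'.eq_iff p.1 p.2
    tauto

/-- Let `σ, τ` be partial ballots, let `σ'` be obtained from `σ` by
appending the candidates listed in `τ` but not in `σ` (in their `τ`-order), and let
`τ'` be obtained symmetrically.  Then (i) `str(σ',τ') = str(σ,τ)` and `wk(σ',τ') = 0`;
(ii) `d_B(σ,σ') + d_B(τ,τ') = wk(σ,τ)/2` and `d_B(σ,τ) = wk(σ,τ)/2 + d_B(σ',τ')`;
(iii) `d_H(σ,σ') + d_H(τ,τ') = wk(σ,τ)/2` and `d_H(σ,τ) = wk(σ,τ)/2 + str(σ',τ')`. -/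
theorem append_waypoints (m : ℕ) (σ τ σ' τ' : Ballot m)
    (hσ' : IsAppend m σ τ σ') (hτ' : IsAppend m τ σ τ') :
    (strDis σ'.1 τ'.1 = strDis σ.1 τ.1 ∧ wkDis σ'.1 τ'.1 = 0) ∧
    (dB m σ.1 σ'.1 + dB m τ.1 τ'.1 = (wkDis σ.1 τ.1 : ℝ) / 2 ∧
      dB m σ.1 τ.1 = (wkDis σ.1 τ.1 : ℝ) / 2 + dB m σ'.1 τ'.1) ∧
    (dH σ.1 σ'.1 + dH τ.1 τ'.1 = (wkDis σ.1 τ.1 : ℝ) / 2 ∧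
      dH σ.1 τ.1 = (wkDis σ.1 τ.1 : ℝ) / 2 + (strDis σ'.1 τ'.1 : ℝ)) := by
  have hstr : strDis σ'.1 τ'.1 = strDis σ.1 τ.1 := by
    rw [strDis, strDis]
    congr 1
    refine Finset.filter_congr fun p _ => and_congr_right fun _ => ?_
    rw [hσ'.lt_iff, hσ'.lt_iff, hτ'.lt_iff, hτ'.lt_iff]
    omega
  have hwk : wkDis σ'.1 τ'.1 = 0 := by
    rw [wkDis, Finset.card_eq_zero, Finset.filter_eq_empty_iff]
    intro p _
    have h1 := hσ'.eq_iff p.1 p.2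
    have h2 := hτ'.eq_iff p.1 p.2
    tauto
  have hsum : (wkDis σ.1 τ.1 : ℝ) =
      ∑ i, (tieBreak σ.1 τ.1 i : ℝ) + ∑ i, (tieBreak τ.1 σ.1 i : ℝ) := by
    rw [← Finset.sum_add_distrib]
    exact_mod_cast (sum_tieBreak σ.1 τ.1).symm
  refine ⟨⟨hstr, hwk⟩, ⟨?_, ?_⟩, ?_, ?_⟩
  · rw [hσ'.dB_eq, hτ'.dB_eq, hsum]
    ring
  · have hpt : ∀ i, |bordaEmb m σ.1 i - bordaEmb m τ.1 i| =
        tieBreak σ.1 τ.1 i + tieBreak τ.1 σ.1 i +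
          |bordaEmb m σ'.1 i - bordaEmb m τ'.1 i| := fun i => by
      rw [hσ'.bordaEmb_eq, hτ'.bordaEmb_eq]
      have hα := tieBreak_le_bordaEmb σ τ i
      have hβ := tieBreak_le_bordaEmb τ σ i
      have hα0 : (0 : ℝ) ≤ tieBreak σ.1 τ.1 i := Nat.cast_nonneg _
      have hβ0 : (0 : ℝ) ≤ tieBreak τ.1 σ.1 i := Nat.cast_nonneg _
      rcases tieBreak_eq_zero_or_bordaEmb_eq_zero σ τ i with h | h
      · rcases tieBreak_eq_zero_or_bordaEmb_eq_zero τ σ i with h' | h'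
        · simp [h, h']
        · rw [h, h', abs_of_nonneg (by linarith), abs_of_nonneg (by linarith)]
          ring
      · have hβ' : (tieBreak τ.1 σ.1 i : ℝ) = 0 := by linarith
        rw [h, hβ', abs_of_nonpos (by linarith), abs_of_nonpos (by linarith)]
        ring
    simp only [dB, hpt, Finset.sum_add_distrib]
    rw [hsum]
    ring
  · rw [dH_eq, dH_eq, hσ'.strDis_eq_zero, hτ'.strDis_eq_zero, ← hσ'.wkDis_add hτ']
    push_cast
    ring
  · rw [dH_eq, hstr]
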